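/- For $\xi = (\xi_1, \xi_2, \xi_3) \in \mathbb{R}^3$, let $l(\xi)$ be the real $6\times 6$ matrix $l(\xi) = \frac{1}{12} M(\xi)$, where, writing $q = \xi_1^2 + \xi_2^2 + \xi_3^2$, the rows of $M(\xi)$ are: row 1: $(7q - \xi_3^2,\ -2\xi_1\xi_3,\ \xi_2^2 - \xi_1^2,\ 0,\ -2\xi_2\xi_3,\ -2\xi_1\xi_2)$; row 2: $(-\xi_1\xi_3,\ 6q + 2\xi_3^2,\ \xi_1\xi_3,\ \xi_2\xi_3,\ 0,\ \xi_2\xi_3)$; row 3: $(\xi_2^2 - \xi_1^2,\ 2\xi_1\xi_3,\ 7q - \xi_3^2,\ 2\xi_1\xi_2,\ -2\xi_2\xi_3,\ 0)$; row 4: $(0,\ 2\xi_2\xi_3,\ 2\xi_1\xi_2,\ 7q - \xi_3^2,\ -2\xi_1\xi_3,\ \xi_2^2 - \xi_1^2)$; row 5: $(-\xi_2\xi_3,\ 0,\ -\xi_2\xi_3,\ -\xi_1\xi_3,\ 6q + 2\xi_3^2,\ \xi_1\xi_3)$; row 6: $(-2\xi_1\xi_2,\ 2\xi_2\xi_3,\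 0,\ \xi_2^2 - \xi_1^2,\ 2\xi_1\xi_3,\ 7q - \xi_3^2)$. Then $\det l(\xi) = \frac{1}{36}(\xi_1^2 + \xi_2^2 + \xi_3^2)^6$. Consequently $l(\xi)$ is invertible if and only if $\xi \neq 0$. -/

import Mathlib

/-- The principal symbol, in a Cartesian frame, of the approximate Killing spinor operator,
as a real 6×6 matrix depending on ξ = (ξ₁, ξ₂, ξ₃) ∈ ℝ³. It acts on the column
(Re κ₀₀, Re κ₀₁, Re κ₁₁, Im κ₀₀, Im κ₀₁, Im κ₁₁). -/
noncomputable def symbolMatrix (ξ₁ ξ₂ ξ₃ : ℝ) : Matrix (Fin 6) (Fin 6) ℝ :=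
  let q := ξ₁ ^ 2 + ξ₂ ^ 2 + ξ₃ ^ 2
  (1 / 12 : ℝ) •
    !![7 * q - ξ₃ ^ 2, -2 * ξ₁ * ξ₃, ξ₂ ^ 2 - ξ₁ ^ 2, 0, -2 * ξ₂ * ξ₃, -2 * ξ₁ * ξ₂;
       -(ξ₁ * ξ₃), 6 * q + 2 * ξ₃ ^ 2, ξ₁ * ξ₃, ξ₂ * ξ₃, 0, ξ₂ * ξ₃;
       ξ₂ ^ 2 - ξ₁ ^ 2, 2 * ξ₁ * ξ₃, 7 * q - ξ₃ ^ 2, 2 * ξ₁ * ξ₂, -2 * ξ₂ * ξ₃, 0;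
       0, 2 * ξ₂ * ξ₃, 2 * ξ₁ * ξ₂, 7 * q - ξ₃ ^ 2, -2 * ξ₁ * ξ₃, ξ₂ ^ 2 - ξ₁ ^ 2;
       -(ξ₂ * ξ₃), 0, -(ξ₂ * ξ₃), -(ξ₁ * ξ₃), 6 * q + 2 * ξ₃ ^ 2, ξ₁ * ξ₃;
       -2 * ξ₁ * ξ₂, 2 * ξ₂ * ξ₃, 0, ξ₂ ^ 2 - ξ₁ ^ 2, 2 * ξ₁ * ξ₃, 7 * q - ξ₃ ^ 2]

/-- A factor of the rank-two part of the symbol: the realification of the complex column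
`(w, -ξ₃, -w̄)` with `w = ξ₁ - i ξ₂`. -/
def symbolColumn (ξ₁ ξ₂ ξ₃ : ℝ) : Matrix (Fin 6) (Fin 2) ℝ :=
  !![ξ₁, ξ₂; -ξ₃, 0; -ξ₁, ξ₂; -ξ₂, ξ₁; 0, -ξ₃; -ξ₂, -ξ₁]

/-- A factor of the rank-two part of the symbol: the realification of the complex row
`(w̄, -2 ξ₃, -w)` with `w = ξ₁ - i ξ₂`. -/
def symbolRow (ξ₁ ξ₂ ξ₃ : ℝ) : Matrix (Fin 2) (Fin 6) ℝ :=
  !![ξ₁, -2 * ξ₃, -ξ₁, -ξ₂, 0, -ξ₂; ξ₂, 0, ξ₂, ξ₁, -2 * ξ₃, -ξ₁]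

set_option maxHeartbeats 1000000 in
theorem symbolMatrix_eq (ξ₁ ξ₂ ξ₃ : ℝ) :
    symbolMatrix ξ₁ ξ₂ ξ₃ = (1 / 12 : ℝ) • ((6 * (ξ₁ ^ 2 + ξ₂ ^ 2 + ξ₃ ^ 2)) • 1 +
      symbolColumn ξ₁ ξ₂ ξ₃ * symbolRow ξ₁ ξ₂ ξ₃) := by
  unfold symbolMatrix symbolColumn symbolRow
  ext i j
  fin_cases i <;> fin_cases j <;> simp <;> ring

theorem symbolRow_mul_symbolColumn (ξ₁ ξ₂ ξ₃ : ℝ) :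
    symbolRow ξ₁ ξ₂ ξ₃ * symbolColumn ξ₁ ξ₂ ξ₃ =
      (2 * (ξ₁ ^ 2 + ξ₂ ^ 2 + ξ₃ ^ 2)) • (1 : Matrix (Fin 2) (Fin 2) ℝ) := by
  unfold symbolColumn symbolRow
  ext i j
  fin_cases i <;> fin_cases j <;> simp [Matrix.mul_apply, Fin.sum_univ_six] <;> ring

/-- If `V * U` is the scalar matrix `d`, then `c + U * V` has the eigenvalues `c` and `c + d`. -/
theorem det_smul_one_add_mul_of_mul_eq_smul_one {K m n : Type*} [Field K] [Fintype m]
    [DecidableEq m] [Fintype n] [DecidableEq n] {c d : K} (hc : c ≠ 0) {U : Matrix m n K}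
    {V : Matrix n m K} (h : V * U = d • (1 : Matrix n n K)) :
    (c • (1 : Matrix m m K) + U * V).det =
      c ^ Fintype.card m * (1 + c⁻¹ * d) ^ Fintype.card n := by
  have hfac : c • (1 : Matrix m m K) + U * V = c • (1 + U * (c⁻¹ • V)) := by
    rw [smul_add, Matrix.mul_smul, smul_inv_smul₀ hc]
  have hred : (1 : Matrix n n K) + c⁻¹ • V * U = (1 + c⁻¹ * d) • 1 := by
    rw [Matrix.smul_mul, h, smul_smul, add_smul, one_smul]
  rw [hfac, Matrix.det_smul, Matrix.det_one_add_mul_comm, hred, Matrix.det_smul, Matrix.det_one,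
    mul_one]

/-- det l(ξ) = (1/36)(ξ₁² + ξ₂² + ξ₃²)⁶; consequently l(ξ) is invertible iff ξ ≠ 0. -/
theorem symbolMatrix_det (ξ₁ ξ₂ ξ₃ : ℝ) :
    (symbolMatrix ξ₁ ξ₂ ξ₃).det = (1 / 36 : ℝ) * (ξ₁ ^ 2 + ξ₂ ^ 2 + ξ₃ ^ 2) ^ 6 ∧
    (IsUnit (symbolMatrix ξ₁ ξ₂ ξ₃) ↔ ¬(ξ₁ = 0 ∧ ξ₂ = 0 ∧ ξ₃ = 0)) := by
  have hq : ξ₁ ^ 2 + ξ₂ ^ 2 + ξ₃ ^ 2 = 0 ↔ ξ₁ = 0 ∧ ξ₂ = 0 ∧ ξ₃ = 0 := by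
    constructor
    · intro h
      refine ⟨?_, ?_, ?_⟩ <;> nlinarith [sq_nonneg ξ₁, sq_nonneg ξ₂, sq_nonneg ξ₃]
    · rintro ⟨rfl, rfl, rfl⟩
      norm_num
  have hdet : (symbolMatrix ξ₁ ξ₂ ξ₃).det =
      (1 / 36 : ℝ) * (ξ₁ ^ 2 + ξ₂ ^ 2 + ξ₃ ^ 2) ^ 6 := by
    by_cases h : ξ₁ ^ 2 + ξ₂ ^ 2 + ξ₃ ^ 2 = 0
    · obtain ⟨rfl, rfl, rfl⟩ := hq.1 h
      rw [h, Matrix.det_eq_zero_of_row_eq_zero 0]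
      · norm_num
      · intro j
        fin_cases j <;> simp [symbolMatrix]
    · rw [symbolMatrix_eq, Matrix.det_smul, det_smul_one_add_mul_of_mul_eq_smul_one
        (mul_ne_zero (by norm_num) h) (symbolRow_mul_symbolColumn ξ₁ ξ₂ ξ₃)]
      simp only [Fintype.card_fin]
      field_simp
      norm_num
  refine ⟨hdet, ?_⟩
  rw [Matrix.isUnit_iff_isUnit_det, isUnit_iff_ne_zero, hdet, ← hq]
  simp
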